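/- arXiv:1802.05053 — 2 statements merged into one kernel-verified Lean document; each statement's English description precedes it below -/
import Mathlib

section
/- For every l ≥ 2 and every admissible configuration y ∈ 𝒰^l ∩ 𝒜_{l+1} with index i₀, one has i₀ ≤ ⌈2π/ψ̄⌉ − 2 and l + 1 − i₀ ≤ ⌈2π/ψ̄⌉ − 2. In particular, 𝒰^l ∩ 𝒜_{l+1} = ∅ for every l ≥ l_max = 2⌈2π/ψ̄⌉ − 4. -/
open Real

attribute [local instance] Classical.propDecidable

noncomputable section

/-- Counterclockwise angle from `a` to `b`, in `[0, 2π)`. -/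
def ccwAngle (a b : ℂ) : ℝ :=
  if Complex.arg (b * (starRingEnd ℂ) a) < 0 then
    Complex.arg (b * (starRingEnd ℂ) a) + 2 * π
  else Complex.arg (b * (starRingEnd ℂ) a)

/-- Bond length `b_i`. -/
def bnd (y : ℕ → ℂ) (i : ℕ) : ℝ := ‖y (i + 1) - y i‖

/-- Bond angle `φ_i = ∡(y_{i-1} − y_i, y_{i+1} − y_i)`. -/
def ang (y : ℕ → ℂ) (i : ℕ) : ℝ := ccwAngle (y (i - 1) - y i) (y (i + 1) - y i)

/-- Admissible configurations `𝒜_n` (atoms indexed `1,…,n`). -/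
def Admissible (n : ℕ) (y : ℕ → ℂ) : Prop :=
  (∀ i j : ℕ, 1 ≤ i → i ≤ n → 1 ≤ j → j ≤ n → (i + 2 ≤ j ∨ j + 2 ≤ i) →
      (1.5 : ℝ) < ‖y i - y j‖) ∧
  (∀ i : ℕ, 1 ≤ i → i + 1 ≤ n → ‖y (i + 1) - y i‖ ≤ (1.5 : ℝ))

/-- Assumptions on the two-body potential `v₂` and the three-body potential `v₃`. -/
structure PotentialPair (v₂ v₃ : ℝ → ℝ) : Prop where
  v₂_smooth : ContDiffOn ℝ (⊤ : ℕ∞) v₂ (Set.Ioi 0)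
  v₂_lb : ∀ x ∈ Set.Ioi (0 : ℝ), (-1 : ℝ) ≤ v₂ x
  v₂_min : v₂ 1 = -1
  v₂_min_unique : ∀ x ∈ Set.Ioi (0 : ℝ), x ≠ 1 → v₂ 1 < v₂ x
  v₂_conv : 0 < iteratedDeriv 2 v₂ 1
  v₂_mono : StrictMonoOn v₂ (Set.Ici 1)
  v₃_smooth : ContDiffOn ℝ (⊤ : ℕ∞) v₃ (Set.Icc 0 (2 * π))
  v₃_nonneg : ∀ x ∈ Set.Icc (0 : ℝ) (2 * π), 0 ≤ v₃ x
  v₃_symm : ∀ φ : ℝ, v₃ (π - φ) = v₃ (π + φ)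
  v₃_min : v₃ π = 0
  v₃_min_unique : ∀ x ∈ Set.Icc (0 : ℝ) (2 * π), x ≠ π → 0 < v₃ x
  v₃_d1 : deriv v₃ π = 0
  v₃_d2 : iteratedDeriv 2 v₃ π = 0
  v₃_d3 : iteratedDeriv 3 v₃ π = 0
  v₃_d4 : 0 < iteratedDeriv 4 v₃ π

/-- The cell energy in terms of bond lengths and angle. -/
def EcellT (v₂ v₃ : ℝ → ℝ) (ρ b₁ b₂ φ : ℝ) : ℝ :=
  v₂ b₁ + v₂ b₂ + ρ * v₂ (Real.sqrt (b₁ ^ 2 + b₂ ^ 2 - 2 * b₁ * b₂ * Real.cos φ)) + v₃ φ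

/-- The cell energy. -/
def Ecell (v₂ v₃ : ℝ → ℝ) (ρ : ℝ) (p q r : ℂ) : ℝ :=
  v₂ ‖q - p‖ + v₂ ‖r - q‖ + v₃ (ccwAngle (r - q) (p - q)) + ρ * v₂ ‖r - p‖

/-- The reduced energy `E^red_n`. -/
def Ered (v₂ v₃ : ℝ → ℝ) (ρ : ℝ) (n : ℕ) (y : ℕ → ℂ) : ℝ :=
  ∑ i ∈ Finset.Icc 2 (n - 1), Ecell v₂ v₃ ρ (y (i - 1)) (y i) (y (i + 1))

/-- `(b0, b0, π ± ψ)` are the only minimizers of the cell energy. -/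
def IsCellMinimizer (v₂ v₃ : ℝ → ℝ) (ρ b0 ψ : ℝ) : Prop :=
  0 < b0 ∧ b0 < 1 ∧ 0 < ψ ∧ ψ < π / 8 ∧
  (∀ b₁ ∈ Set.Ioi (0 : ℝ), ∀ b₂ ∈ Set.Ioi (0 : ℝ), ∀ φ ∈ Set.Icc (0 : ℝ) (2 * π),
      EcellT v₂ v₃ ρ b0 b0 (π + ψ) ≤ EcellT v₂ v₃ ρ b₁ b₂ φ) ∧
  (∀ b₁ ∈ Set.Ioi (0 : ℝ), ∀ b₂ ∈ Set.Ioi (0 : ℝ), ∀ φ ∈ Set.Icc (0 : ℝ) (2 * π),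
      EcellT v₂ v₃ ρ b₁ b₂ φ = EcellT v₂ v₃ ρ b0 b0 (π + ψ) →
        b₁ = b0 ∧ b₂ = b0 ∧ (φ = π + ψ ∨ φ = π - ψ))

/-- The minimal cell energy `e_cell`. -/
def eCell (v₂ v₃ : ℝ → ℝ) (ρ b0 ψ : ℝ) : ℝ := EcellT v₂ v₃ ρ b0 b0 (π + ψ)

/-- `y` is a minimizer of `E^red_n` over `𝒜_n`. -/
def MinimizesEred (v₂ v₃ : ℝ → ℝ) (ρ : ℝ) (n : ℕ) (y : ℕ → ℂ) : Prop :=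
  Admissible n y ∧ ∀ y' : ℕ → ℂ, Admissible n y' → Ered v₂ v₃ ρ n y ≤ Ered v₂ v₃ ρ n y'

/-- Single-period configurations `𝒰^l`, with transition index `i₀`. -/
def memU (b0 ψ : ℝ) (l i₀ : ℕ) (y : ℕ → ℂ) : Prop :=
  2 ≤ i₀ ∧ i₀ + 1 ≤ l ∧
  (∀ i : ℕ, 1 ≤ i → i ≤ l → bnd y i = b0) ∧
  (∀ i : ℕ, 2 ≤ i → i ≤ i₀ → ang y i = π - ψ) ∧
  (∀ i : ℕ, i₀ + 1 ≤ i → i ≤ l → ang y i = π + ψ)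

/-- `⌈2π/ψ̄⌉`. -/
def nceil (ψ : ℝ) : ℕ := ⌈2 * π / ψ⌉₊

/-- The maximal atomic period `l_max = 2⌈2π/ψ̄⌉ − 4`. -/
def lmaxN (ψ : ℝ) : ℕ := 2 * nceil ψ - 4

/-- `l_mid = ⌊6/ψ̄⌋`. -/
def lmidN (ψ : ℝ) : ℕ := ⌊(6 : ℝ) / ψ⌋₊

/-- The end-to-end length `λ^l(i₀)` of a single-period configuration. -/
def lambdaFn (b0 ψ : ℝ) (l i₀ : ℕ) : ℝ :=
  ‖∑ k ∈ Finset.Icc 1 l, (b0 : ℂ) * Complex.exp (Complex.I *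
      (((if k ≤ i₀ then -(((k : ℝ) - 1) * ψ) else ((k : ℝ) - 2 * (i₀ : ℝ) + 1) * ψ) : ℝ) : ℂ))‖

/-- The domain of the function `λ^l`. -/
def lambdaDom (ψ : ℝ) (l : ℕ) : Finset ℕ :=
  (Finset.Icc 2 (l - 1)).filter fun i₀ => l + 3 ≤ i₀ + nceil ψ ∧ i₀ + 2 ≤ nceil ψ

/-- `λ^l_max`, the maximum of `λ^l` over its domain. -/
def lambdaMax (b0 ψ : ℝ) (l : ℕ) : ℝ :=
  sSup (lambdaFn b0 ψ l '' ↑(lambdaDom ψ l))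

/-- `f` is affine on `s`. -/
def AffOn (f : ℝ → ℝ) (s : Set ℝ) : Prop := ∃ a b : ℝ, ∀ x ∈ s, f x = a * x + b

/-- `Lam` is the normalized wavelength `Λ`. -/
def IsNormWavelength (b0 ψ : ℝ) (Lam : ℝ → ℝ) : Prop :=
  (∀ l : ℕ, 2 ≤ l → l ≤ lmidN ψ → Even l → Lam (l : ℝ) = lambdaMax b0 ψ l / (l : ℝ)) ∧
  (∀ l : ℕ, 4 ≤ l → l ≤ lmidN ψ → Even l → AffOn Lam (Set.Icc ((l : ℝ) - 2) (l : ℝ))) ∧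
  AffOn Lam (Set.Icc ((lmidN ψ : ℝ) - 2) (lmaxN ψ : ℝ))

/-- `y ∈ 𝒰^l_δ`, with associated configuration `ybar ∈ 𝒰^l`. -/
def AssocPerturb (b0 ψ δ : ℝ) (l : ℕ) (y ybar : ℕ → ℂ) : Prop :=
  Admissible (l + 1) y ∧ (∃ i₀ : ℕ, memU b0 ψ l i₀ ybar) ∧
  (∀ i : ℕ, 1 ≤ i → i ≤ l → |bnd y i - b0| ≤ δ) ∧
  (∀ i : ℕ, 2 ≤ i → i ≤ l → |ang y i - ang ybar i| ≤ δ)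

/-- `𝒜^δ_n`. -/
def AdmissiblePerturbed (b0 ψ δ : ℝ) (n : ℕ) (y : ℕ → ℂ) : Prop :=
  Admissible n y ∧ (∀ i : ℕ, 1 ≤ i → i + 1 ≤ n → |bnd y i - b0| ≤ δ) ∧
  (∀ i : ℕ, 2 ≤ i → i + 1 ≤ n → min |ang y i - (π + ψ)| |ang y i - (π - ψ)| ≤ δ)

/-- The property of the constant `c_mix` in the length estimate for odd atomic periods. -/
def MixConst (b0 ψ c : ℝ) : Prop :=
  ∀ l₁ l₂ : ℕ, Odd l₁ → Odd l₂ → 2 ≤ l₁ → l₁ ≤ lmaxN ψ → 2 ≤ l₂ → l₂ ≤ lmaxN ψ →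
    ∀ y : ℕ → ℂ,
      (∃ i₀ : ℕ, memU b0 ψ (l₁ + 1) i₀ y) →
      (∃ i₀ : ℕ, memU b0 ψ (l₂ - 1) i₀ (fun i => y (i + l₁ + 1))) →
      (∃ m : ℤ, ang y (l₁ + 2) - π = (2 * (m : ℝ) + 1) * ψ) →
      ‖y (l₁ + l₂ + 1) - y 1‖ ≤
        max (lambdaMax b0 ψ (l₁ + 1) + lambdaMax b0 ψ (l₂ - 1))
            (lambdaMax b0 ψ (l₁ - 1) + lambdaMax b0 ψ (l₂ + 1))
          - (if l₂ ≤ l₁ then c else 0)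

/-- `𝓘_sgn`. -/
def Isgn (n : ℕ) (y : ℕ → ℂ) : Finset ℕ :=
  ((Finset.Icc 3 (n - 2)).filter fun i => π < ang y i ∧ ang y (i + 1) < π) ∪ {1}

/-- `𝓘^l_sgn`. -/
def IsgnL (n : ℕ) (y : ℕ → ℂ) (l : ℕ) : Finset ℕ :=
  (Isgn n y).filter fun i =>
    (∀ k : ℕ, 1 ≤ k → k ≤ l - 1 → i + k ∉ Isgn n y) ∧ (i + l ∈ Isgn n y ∨ i + l = n)

/-- The maximal length of odd atomic periods `ℒ`. -/
def maxOddLength (ψ : ℝ) (Lam : ℝ → ℝ) (N S : ℕ) : ℝ :=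
  sSup { x : ℝ | ∃ r : ℕ → ℕ,
    (∀ l : ℕ, r l ≠ 0 → Even l ∧ 2 ≤ l ∧ l ≤ lmaxN ψ) ∧
    (∑ l ∈ Finset.Icc 2 (lmaxN ψ), r l) = N ∧
    (∑ l ∈ Finset.Icc 2 (lmaxN ψ), l * r l) = 2 * (S / 2) ∧
    x = ∑ l ∈ Finset.Icc 2 (lmaxN ψ), (r l : ℝ) * (l : ℝ) * Lam (l : ℝ) }

/-- The generalized cell energy. -/
def EgenCell (v₂ v₃ : ℝ → ℝ) (ρ ρ' : ℝ) (p q r s : ℂ) : ℝ :=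
  (Ecell v₂ v₃ ρ p q r + Ecell v₂ v₃ ρ q r s) / 2 + ρ' * v₂ ‖s - p‖

/-- The configurational (general) energy `E_n`. -/
def Egen (v₂ v₃ : ℝ → ℝ) (ρ ρ' : ℝ) (n : ℕ) (y : ℕ → ℂ) : ℝ :=
  Ered v₂ v₃ ρ n y + ρ' * ∑ i ∈ Finset.Icc 1 (n - 3), v₂ ‖y (i + 3) - y i‖

/-- The boundary condition `(y_n − y_1)·e₁ = (n−1)μ`. -/
def BC (n : ℕ) (μ : ℝ) (y : ℕ → ℂ) : Prop := (y n - y 1).re = ((n : ℝ) - 1) * μ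

/-- The minimal energy `E^{n,μ}_min`. -/
def Emin (v₂ v₃ : ℝ → ℝ) (ρ ρ' μ : ℝ) (n : ℕ) : ℝ :=
  sInf {E : ℝ | ∃ y : ℕ → ℂ, Admissible n y ∧ BC n μ y ∧ E = Egen v₂ v₃ ρ ρ' n y} /
    ((n : ℝ) - 2)

/-- `egen` is the common value `e^gen_cell`. -/
def IsEgenCellVal (v₂ v₃ : ℝ → ℝ) (ρ ρ' egen : ℝ) : Prop :=
  ∀ n : ℕ, ∀ y : ℕ → ℂ, MinimizesEred v₂ v₃ ρ n y →
    ∀ i : ℕ, 1 ≤ i → i + 3 ≤ n →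
      Real.sign (ang y (i + 1) - π) = Real.sign (ang y (i + 2) - π) →
        EgenCell v₂ v₃ ρ ρ' (y i) (y (i + 1)) (y (i + 2)) (y (i + 3)) = egen

/-- `eper` is the common value `e_per`. -/
def IsEperVal (v₂ v₃ : ℝ → ℝ) (ρ ρ' egen eper : ℝ) : Prop :=
  ∀ n : ℕ, ∀ y : ℕ → ℂ, MinimizesEred v₂ v₃ ρ n y →
    ∀ i : ℕ, 1 ≤ i → i + 3 ≤ n →
      Real.sign (ang y (i + 1) - π) ≠ Real.sign (ang y (i + 2) - π) →
        EgenCell v₂ v₃ ρ ρ' (y i) (y (i + 1)) (y (i + 2)) (y (i + 3)) = egen + ρ' * eper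

/-- `f` is piecewise affine on `s`. -/
def PiecewiseAffOn (f : ℝ → ℝ) (s : Set ℝ) : Prop :=
  ∃ P : Finset ℝ, ∀ a b : ℝ, a ∈ s → b ∈ s → a ≤ b → (∀ z ∈ P, z ∉ Set.Ioo a b) →
    AffOn f (Set.Icc a b ∩ s)

/-- The data `(e^gen_cell, e_range, c)` from the characterization of the minimal energy. -/
def EnergyChar (v₂ v₃ : ℝ → ℝ) (ρ ρ' m₁ m₂ egen : ℝ) (erange : ℝ → ℝ) (c : ℝ) : Prop :=
  0 < c ∧ StrictMonoOn erange (Set.Icc m₁ m₂) ∧ ConvexOn ℝ (Set.Icc m₁ m₂) erange ∧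
  PiecewiseAffOn erange (Set.Icc m₁ m₂) ∧
  ∀ μ ∈ Set.Icc m₁ m₂, ∀ n : ℕ, 3 ≤ n →
    |egen + ρ' * erange μ - Emin v₂ v₃ ρ ρ' μ n| ≤ c * (ρ' ^ 2 + 1 / (n : ℝ))

/-- The set of resonant lengths `M_res`. -/
def Mres (m₁ m₂ : ℝ) (erange : ℝ → ℝ) : Set ℝ :=
  {μ | μ ∈ Set.Icc m₁ m₂ ∧ ¬ DifferentiableWithinAt ℝ erange (Set.Icc m₁ m₂) μ}

/-- `𝒞(y)`, the set of atoms where the chain changes its curvature. -/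
def Cset (n : ℕ) (y : ℕ → ℂ) : Finset ℕ :=
  (Finset.Icc 2 (n - 2)).filter fun i => π < ang y i ∧ ang y (i + 1) < π

/-- `j` is the successor of `i` in `C`. -/
def SuccIn (C : Finset ℕ) (i j : ℕ) : Prop :=
  i ∈ C ∧ j ∈ C ∧ i < j ∧ ∀ k ∈ C, i < k → j ≤ k

/-- Almost minimizers of `E^{n,μ}_min`. -/
def AlmostMin (v₂ v₃ : ℝ → ℝ) (ρ ρ' μ c : ℝ) (n : ℕ) (y : ℕ → ℂ) : Prop :=
  Admissible n y ∧ BC n μ y ∧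
    Egen v₂ v₃ ρ ρ' n y / ((n : ℝ) - 2) ≤ Emin v₂ v₃ ρ ρ' μ n + c * (ρ' ^ 2 + 1 / (n : ℝ))

lemma ccw_exp (a b : ℂ) :
    b * (starRingEnd ℂ) a
      = (‖b * (starRingEnd ℂ) a‖ : ℂ) * Complex.exp ((ccwAngle a b : ℝ) * Complex.I) := by
  unfold ccwAngle
  split_ifs with h
  · have : (((Complex.arg (b * (starRingEnd ℂ) a) + 2 * π : ℝ) : ℂ)) * Complex.I
        = (Complex.arg (b * (starRingEnd ℂ) a) : ℂ) * Complex.I + 2 * π * Complex.I := by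
      push_cast; ring
    rw [this, Complex.exp_add, Complex.exp_two_pi_mul_I, mul_one, Complex.norm_mul_exp_arg_mul_I]
  · rw [Complex.norm_mul_exp_arg_mul_I]

lemma bond_step (y : ℕ → ℂ) (b0 t : ℝ) (hb0 : 0 < b0) (i : ℕ)
    (h1 : bnd y i = b0) (h2 : bnd y (i + 1) = b0) (h3 : ang y (i + 1) = π + t) :
    y (i + 2) - y (i + 1) = Complex.exp (Complex.I * (t : ℝ)) * (y (i + 1) - y i) := by
  have h := ccw_exp (y i - y (i + 1)) (y (i + 2) - y (i + 1))
  have h3' : ccwAngle (y i - y (i + 1)) (y (i + 2) - y (i + 1)) = π + t := h3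
  unfold bnd at h1 h2
  have h1' : ‖y i - y (i + 1)‖ = b0 := by rw [norm_sub_rev]; exact h1
  have h2' : ‖y (i + 2) - y (i + 1)‖ = b0 := h2
  rw [h3', norm_mul, RCLike.norm_conj, h1', h2'] at h
  have he : Complex.exp (((π + t : ℝ) : ℂ) * Complex.I) = - Complex.exp (Complex.I * (t : ℝ)) := by
    have : ((π + t : ℝ) : ℂ) * Complex.I = π * Complex.I + Complex.I * (t : ℝ) := by
      push_cast; ring
    rw [this, Complex.exp_add, Complex.exp_pi_mul_I]; ring
  rw [he] at h
  have hn : (starRingEnd ℂ) (y i - y (i + 1)) * (y i - y (i + 1)) = ((b0 : ℂ)) ^ 2 := by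
    rw [Complex.conj_mul', h1']
  have hb : ((b0 : ℂ)) ^ 2 ≠ 0 := pow_ne_zero _ (by exact_mod_cast hb0.ne')
  apply mul_right_cancel₀ hb
  have h' := congrArg (· * (y i - y (i + 1))) h
  simp only [mul_assoc, hn] at h'
  rw [h']
  push_cast
  ring

lemma arc_geom (y : ℕ → ℂ) (r : ℂ) (a m : ℕ)
    (h : ∀ k, k + 1 < m → y (a + k + 2) - y (a + k + 1) = r * (y (a + k + 1) - y (a + k))) :
    (∀ k, k < m → y (a + k + 1) - y (a + k) = r ^ k * (y (a + 1) - y a)) ∧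
    (y (a + m) - y a) * (r - 1) = (r ^ m - 1) * (y (a + 1) - y a) := by
  have h1 : ∀ k, k < m → y (a + k + 1) - y (a + k) = r ^ k * (y (a + 1) - y a) := by
    intro k
    induction k with
    | zero => intro _; simp
    | succ k ih =>
      intro hk
      have := h k hk
      rw [ih (by omega)] at this
      rw [pow_succ']
      rw [mul_assoc, ← this]
      rfl
  refine ⟨h1, ?_⟩
  have h2 : ∀ k, k ≤ m → (y (a + k) - y a) * (r - 1) = (r ^ k - 1) * (y (a + 1) - y a) := by
    intro k
    induction k with
    | zero => intro _; simp
    | succ k ih =>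
      intro hk
      have e1 := h1 k (by omega)
      have e2 := ih (by omega)
      have : y (a + (k + 1)) = y (a + k) + r ^ k * (y (a + 1) - y a) := by
        rw [← e1]; simp [add_assoc]
      rw [this]
      linear_combination e2
  exact h2 m le_rfl

lemma sin_bound (ψ : ℝ) (hψ0 : 0 < ψ) (hψ1 : ψ < π / 8) :
    3 ≤ nceil ψ ∧ |Real.sin (((nceil ψ - 1 : ℕ) : ℝ) * ψ / 2)| ≤ |Real.sin (ψ / 2)|
      ∧ 0 < Real.sin (ψ / 2) := by
  have hpi := Real.pi_pos
  have hle : 2 * π / ψ ≤ nceil ψ := Nat.le_ceil _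
  have hlt : (nceil ψ : ℝ) < 2 * π / ψ + 1 := Nat.ceil_lt_add_one (by positivity)
  have e : 2 * π / ψ * ψ = 2 * π := by field_simp
  have h16 : (16 : ℝ) < 2 * π / ψ := by
    rw [lt_div_iff₀ hψ0]; linarith
  have h3 : 3 ≤ nceil ψ := by
    have : (3 : ℝ) ≤ nceil ψ := by linarith
    exact_mod_cast this
  have hs : 0 < Real.sin (ψ / 2) := Real.sin_pos_of_pos_of_lt_pi (by linarith) (by linarith)
  refine ⟨h3, ?_, hs⟩
  rw [Nat.cast_sub (by omega), Nat.cast_one]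
  have l1 : 2 * π - ψ ≤ ((nceil ψ : ℝ) - 1) * ψ := by nlinarith
  have l2 : ((nceil ψ : ℝ) - 1) * ψ < 2 * π := by nlinarith
  rw [← Real.sin_pi_sub, abs_of_pos hs, abs_of_nonneg
    (Real.sin_nonneg_of_nonneg_of_le_pi (by linarith) (by linarith))]
  exact Real.sin_le_sin_of_le_of_le_pi_div_two (by linarith) (by linarith) (by linarith)

lemma arc_short (y : ℕ → ℂ) (b0 ψ t : ℝ) (hb0 : 0 < b0)
    (hψ0 : 0 < ψ) (hψ1 : ψ < π / 8) (ht : t = ψ ∨ t = -ψ) (a : ℕ)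
    (hb : ∀ k, k + 1 < nceil ψ → bnd y (a + k) = b0)
    (hang : ∀ k, k + 2 < nceil ψ → ang y (a + k + 1) = π + t) :
    ‖y a - y (a + (nceil ψ - 1))‖ ≤ b0 := by
  obtain ⟨h3, hs, hpos⟩ := sin_bound ψ hψ0 hψ1
  obtain ⟨-, hg⟩ := arc_geom y (Complex.exp (Complex.I * (t : ℝ))) a (nceil ψ - 1) (by
    intro k hk
    exact bond_step y b0 t hb0 (a + k) (hb k (by omega)) (hb (k + 1) (by omega))
      (hang k (by omega)))
  have hn := congrArg norm hg
  have hb' : ‖y (a + 1) - y a‖ = b0 := hb 0 (by omega)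
  have hp : Complex.exp (Complex.I * (t : ℝ)) ^ (nceil ψ - 1)
      = Complex.exp (Complex.I * ((((nceil ψ - 1 : ℕ) : ℝ) * t : ℝ) : ℂ)) := by
    rw [← Complex.exp_nat_mul]; congr 1; push_cast; ring
  rw [norm_mul, norm_mul, hp, Complex.norm_exp_I_mul_ofReal_sub_one,
    Complex.norm_exp_I_mul_ofReal_sub_one, hb', norm_mul, norm_mul, Real.norm_eq_abs,
    Real.norm_eq_abs, Real.norm_eq_abs] at hn
  have q1 : |Real.sin (t / 2)| = |Real.sin (ψ / 2)| := by
    rcases ht with rfl | rfl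
    · rfl
    · rw [neg_div, Real.sin_neg, abs_neg]
  have q2 : |Real.sin (((nceil ψ - 1 : ℕ) : ℝ) * t / 2)|
      = |Real.sin (((nceil ψ - 1 : ℕ) : ℝ) * ψ / 2)| := by
    rcases ht with rfl | rfl
    · rfl
    · rw [mul_neg, neg_div, Real.sin_neg, abs_neg]
  rw [q1, q2, abs_two] at hn
  rw [norm_sub_rev]
  have hpos' : 0 < |Real.sin (ψ / 2)| := abs_pos.2 hpos.ne'
  by_contra hc
  push Not at hc
  nlinarith

/-- the maximal atomic period. -/
theorem maximal_atomic_period (b0 ψ : ℝ) (hb0 : 0 < b0) (hb1 : b0 < 1)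
    (hψ0 : 0 < ψ) (hψ1 : ψ < π / 8) :
    (∀ l i₀ : ℕ, 2 ≤ l → ∀ y : ℕ → ℂ, memU b0 ψ l i₀ y → Admissible (l + 1) y →
      i₀ + 2 ≤ nceil ψ ∧ (l + 1) + 2 ≤ i₀ + nceil ψ) ∧
    (∀ l : ℕ, lmaxN ψ ≤ l → ∀ y : ℕ → ℂ, ∀ i₀ : ℕ, memU b0 ψ l i₀ y →
      ¬ Admissible (l + 1) y) := by
  have main : ∀ l i₀ : ℕ, ∀ y : ℕ → ℂ, memU b0 ψ l i₀ y → Admissible (l + 1) y →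
      i₀ + 2 ≤ nceil ψ ∧ (l + 1) + 2 ≤ i₀ + nceil ψ := by
    intro l i₀ y ⟨h2, hl, hb, ha1, ha2⟩ ⟨hA, _⟩
    have h3 := (sin_bound ψ hψ0 hψ1).1
    constructor
    · by_contra hc
      have := arc_short y b0 ψ (-ψ) hb0 hψ0 hψ1 (Or.inr rfl) 1
        (fun k hk => hb _ (by omega) (by omega))
        (fun k hk => by rw [ha1 _ (by omega) (by omega)]; ring)
      have h' := hA 1 (1 + (nceil ψ - 1)) (by omega) (by omega) (by omega) (by omega)
        (Or.inl (by omega))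
      norm_num at h'
      linarith
    · by_contra hc
      have := arc_short y b0 ψ ψ hb0 hψ0 hψ1 (Or.inl rfl) i₀
        (fun k hk => hb _ (by omega) (by omega))
        (fun k hk => ha2 _ (by omega) (by omega))
      have h' := hA i₀ (i₀ + (nceil ψ - 1)) (by omega) (by omega) (by omega) (by omega)
        (Or.inl (by omega))
      norm_num at h'
      linarith
  refine ⟨fun l i₀ _ y => main l i₀ y, fun l hl y i₀ hU hA => ?_⟩
  obtain ⟨q1, q2⟩ := main l i₀ y hU hA
  unfold lmaxN at hl
  omega

end
end

section
/- For every l ∈ {2,…,l_max}, the single-period length function i₀ ↦ λ^l(i₀), defined on { i₀ ∈ {2,…,l−1} : l + 3 − ⌈2π/ψ̄⌉ ≤ i₀ ≤ ⌈2π/ψ̄⌉ − 2 }, attains its maximum exactly at the two values i₀ = ⌈l/2⌉ and i₀ = ⌈(l+1)/2⌉. -/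
open Real

attribute [local instance] Classical.propDecidable

noncomputable section

lemma ccw_eq {a b : ℂ} {r θ : ℝ} (hr : 0 < r) (ha : ‖a‖ = r) (hb : ‖b‖ = r)
    (h : ccwAngle a b = θ) : b = a * Complex.exp (θ * Complex.I) := by
  have h1 : b * (starRingEnd ℂ) a = (r ^ 2 : ℝ) * Complex.exp (θ * Complex.I) := by
    have h2 := Complex.norm_mul_exp_arg_mul_I (b * (starRingEnd ℂ) a)
    have h3 : ‖b * (starRingEnd ℂ) a‖ = r ^ 2 := by
      rw [norm_mul, RCLike.norm_conj, ha, hb, sq]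
    rw [h3] at h2
    rw [← h2]
    congr 1
    unfold ccwAngle at h
    split_ifs at h
    · rw [← h]
      push_cast
      rw [add_mul, Complex.exp_add, Complex.exp_two_pi_mul_I, mul_one]
    · rw [h]
  have h4 : (starRingEnd ℂ) a * a = (r ^ 2 : ℝ) := by
    rw [mul_comm, Complex.mul_conj, Complex.normSq_eq_norm_sq, ha]
  have h5 : ((r ^ 2 : ℝ) : ℂ) ≠ 0 := by exact_mod_cast (by positivity : r ^ 2 ≠ 0)
  apply mul_left_cancel₀ h5
  rw [← h4]
  calc _ = b * (starRingEnd ℂ) a * a := by ring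
    _ = _ := by rw [h1, h4]; ring

lemma step {y : ℕ → ℂ} {b0 ψ σ : ℝ} (hb : 0 < b0) {i : ℕ} (h1 : bnd y (i + 1) = b0)
    (h2 : bnd y (i + 2) = b0) (h : ang y (i + 2) = π + σ) :
    y (i + 3) - y (i + 2) = (y (i + 2) - y (i + 1)) * Complex.exp (σ * Complex.I) := by
  unfold bnd at h1 h2
  unfold ang at h
  have e : i + 2 - 1 = i + 1 := by omega
  rw [e] at h
  have := ccw_eq hb (by rw [norm_sub_rev]; exact h1) h2 h
  rw [show i + 3 = i + 2 + 1 from rfl, this]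
  push_cast
  rw [add_mul, Complex.exp_add, Complex.exp_pi_mul_I]
  ring

lemma closed {y : ℕ → ℂ} {b0 ψ : ℝ} {l i₀ : ℕ} (hb : 0 < b0) (h : memU b0 ψ l i₀ y) :
    ‖y (l + 1) - y 1‖ * ‖Complex.exp (ψ * Complex.I) - 1‖ =
      b0 * ‖Complex.exp (ψ * Complex.I) ^ i₀ + Complex.exp (ψ * Complex.I) ^ (l + 1 - i₀)
        - 1 - Complex.exp (ψ * Complex.I)‖ := by
  obtain ⟨h2, hl, hB, hA, hA'⟩ := h
  set ω := Complex.exp (ψ * Complex.I) with hω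
  set w := Complex.exp ((-ψ : ℝ) * Complex.I) with hw
  have hwω : w * ω = 1 := by
    rw [hw, hω, ← Complex.exp_add]; push_cast; simp
  have hwn : ‖w‖ = 1 := Complex.norm_exp_ofReal_mul_I _
  have s1 : ∀ k, k + 1 ≤ i₀ → y (k + 2) - y (k + 1) = (y 2 - y 1) * w ^ k ∧
      (y (k + 2) - y 1) * (ω - 1) * w ^ k = (y 2 - y 1) * w ^ k * (ω - w ^ k) := by
    intro k
    induction k with
    | zero => intro _; simp
    | succ k ih =>
      intro hk
      obtain ⟨i1, i2⟩ := ih (by omega)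
      have := step (ψ := ψ) hb (hB (k + 1) (by omega) (by omega)) (hB (k + 2) (by omega) (by omega))
        (σ := -ψ) (by rw [hA (k + 2) (by omega) (by omega)]; ring)
      rw [← hw] at this
      have e : y (k + 1 + 2) - y (k + 1 + 1) = (y 2 - y 1) * w ^ (k + 1) := by
        rw [show k + 1 + 2 = k + 3 by ring, show k + 1 + 1 = k + 2 by ring, this, i1]; ring
      refine ⟨e, ?_⟩
      have e2 : y (k + 1 + 2) - y 1 = (y (k + 2) - y 1) + (y 2 - y 1) * w ^ (k + 1) := by
        rw [← e]; ring
      rw [e2]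
      linear_combination w * i2 + (y 2 - y 1) * w ^ (2 * k + 1) * hwω
  obtain ⟨p, rfl⟩ : ∃ p, i₀ = p + 1 := ⟨i₀ - 1, by omega⟩
  obtain ⟨a1, a2⟩ := s1 p le_rfl
  have hw0 : w ^ p ≠ 0 := by
    apply pow_ne_zero; intro h0; simp [h0] at hwn
  have a3 : (y (p + 2) - y 1) * (ω - 1) = (y 2 - y 1) * (ω - w ^ p) := by
    apply mul_right_cancel₀ hw0; rw [a2]; ring
  have s2 : ∀ m, p + 1 + m ≤ l → y (p + m + 2) - y (p + m + 1) = (y 2 - y 1) * w ^ p * ω ^ m ∧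
      (y (p + m + 2) - y (p + 2)) * (ω - 1) = (y 2 - y 1) * w ^ p * (ω ^ (m + 1) - ω) := by
    intro m
    induction m with
    | zero => intro _; exact ⟨by simpa using a1, by simp⟩
    | succ m ih =>
      intro hk
      obtain ⟨i1, i2⟩ := ih (by omega)
      have := step (ψ := ψ) hb (hB (p + m + 1) (by omega) (by omega))
        (hB (p + m + 2) (by omega) (by omega))
        (σ := ψ) (by rw [hA' (p + m + 2) (by omega) (by omega)])
      rw [← hω] at this
      have e : y (p + (m + 1) + 2) - y (p + (m + 1) + 1) = (y 2 - y 1) * w ^ p * ω ^ (m + 1) := by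
        rw [show p + (m + 1) + 2 = p + m + 3 by ring, show p + (m + 1) + 1 = p + m + 2 by ring,
          this, i1]
        ring
      refine ⟨e, ?_⟩
      have e2 : y (p + (m + 1) + 2) - y (p + 2) =
          (y (p + m + 2) - y (p + 2)) + (y 2 - y 1) * w ^ p * ω ^ (m + 1) := by
        rw [← e, show p + (m + 1) + 1 = p + m + 2 by ring]; ring
      rw [e2]
      linear_combination i2
  obtain ⟨q, rfl⟩ : ∃ q, l = p + 1 + q := ⟨l - (p + 1), by omega⟩
  obtain ⟨-, a4⟩ := s2 q le_rfl
  have hone : w ^ p * ω ^ p = 1 := by rw [← mul_pow, hwω, one_pow]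
  have a5 : (y (p + 1 + q + 1) - y 1) * (ω - 1) =
      (y 2 - y 1) * w ^ p * (ω ^ (p + 1) + ω ^ (p + 1 + q + 1 - (p + 1)) - 1 - ω) := by
    rw [show p + 1 + q + 1 - (p + 1) = q + 1 by omega, show p + 1 + q + 1 = p + q + 2 by ring]
    linear_combination a3 + a4 - (y 2 - y 1) * ω * hone
  have hb1 : ‖y 2 - y 1‖ = b0 := hB 1 le_rfl (by omega)
  rw [← norm_mul, a5, norm_mul, norm_mul, hb1, norm_pow, hwn, one_pow, mul_one]

/-- Real quadratic form of the squared length. -/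
lemma norm_form (ψ : ℝ) (l i₀ : ℕ) (hi : i₀ ≤ l + 1) :
    ‖Complex.exp (ψ * Complex.I) ^ i₀ + Complex.exp (ψ * Complex.I) ^ (l + 1 - i₀)
        - 1 - Complex.exp (ψ * Complex.I)‖ ^ 2 =
      4 * (cos (|2 * (i₀ : ℝ) - l - 1| * ψ / 2) ^ 2 + cos (ψ / 2) ^ 2
        - 2 * cos (|2 * (i₀ : ℝ) - l - 1| * ψ / 2) * cos (ψ / 2) * cos (l * ψ / 2)) := by
  have hC : cos (|2 * (i₀ : ℝ) - l - 1| * ψ / 2) = cos ((2 * (i₀ : ℝ) - l - 1) * ψ / 2) := by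
    rcases abs_choice (2 * (i₀ : ℝ) - l - 1) with h | h <;> rw [h]
    rw [← cos_neg]; ring_nf
  rw [hC]
  set δ := (2 * (i₀ : ℝ) - l - 1) * ψ / 2 with hδ
  set s := ((l : ℝ) + 1) * ψ / 2 with hs
  have e1 : Complex.exp (ψ * Complex.I) ^ i₀ = Complex.exp ((s + δ : ℝ) * Complex.I) := by
    rw [← Complex.exp_nat_mul]; congr 1; rw [hs, hδ]; push_cast; ring
  have e2 : Complex.exp (ψ * Complex.I) ^ (l + 1 - i₀) =
      Complex.exp ((s - δ : ℝ) * Complex.I) := by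
    rw [← Complex.exp_nat_mul]; congr 1; rw [hs, hδ]
    rw [Nat.cast_sub hi]; push_cast; ring
  have hα : (l : ℝ) * ψ / 2 = s - ψ / 2 := by rw [hs]; ring
  have hψ : Complex.exp (ψ * Complex.I) = Complex.exp ((ψ / 2 + ψ / 2 : ℝ) * Complex.I) := by
    congr 2; push_cast; ring
  rw [e1, e2, hψ, hα, ← Complex.normSq_eq_norm_sq, Complex.normSq_apply]
  simp only [Complex.sub_re, Complex.add_re, Complex.sub_im, Complex.add_im, Complex.one_re,
    Complex.one_im, Complex.exp_ofReal_mul_I_re, Complex.exp_ofReal_mul_I_im]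
  simp only [cos_add, sin_add, cos_sub, sin_sub]
  have t1 := sin_sq_add_cos_sq s
  have t2 := sin_sq_add_cos_sq (ψ / 2)
  generalize cos s = cs at *
  generalize sin s = ss at *
  generalize cos δ = cd at *
  generalize cos (ψ / 2) = ch at *
  generalize sin (ψ / 2) = sh at *
  have r1 : cs * cd - ss * sin δ + (cs * cd + ss * sin δ) - 1 - (ch * ch - sh * sh)
      = 2 * cs * cd - 2 * ch * ch := by linear_combination t2
  rw [r1]
  linear_combination 4 * cd ^ 2 * t1 + 4 * ch ^ 2 * t2

/-- Key inequality. -/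
lemma key {ψ α δ δ₀ : ℝ} (hψ : 0 < ψ) (hψ1 : ψ < π / 8) (h0 : 0 ≤ δ₀) (h01 : δ₀ ≤ ψ / 2)
    (h : δ₀ < δ) (ha : δ ≤ α - 3 * ψ / 2) (hb : δ < 2 * π - α - 3 * ψ / 2) :
    cos δ ^ 2 - 2 * cos δ * cos (ψ / 2) * cos α <
      cos δ₀ ^ 2 - 2 * cos δ₀ * cos (ψ / 2) * cos α := by
  have hp : cos (ψ / 2) ≤ cos δ₀ := cos_le_cos_of_nonneg_of_le_pi h0 (by linarith) h01
  have hlt : cos δ < cos δ₀ := cos_lt_cos_of_nonneg_of_le_pi h0 (by linarith) h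
  have aux : ∀ β : ℝ, β ≤ π → δ ≤ β - 3 * ψ / 2 → 2 * cos (ψ / 2) * cos β < cos δ₀ + cos δ := by
    intro β hβ hd
    have i1 : cos (β - ψ / 2) < cos δ :=
      cos_lt_cos_of_nonneg_of_le_pi (by linarith) (by linarith) (by linarith)
    have i2 : cos (β + ψ / 2) ≤ cos (ψ / 2) := by
      rcases le_total (β + ψ / 2) π with h | h
      · exact cos_le_cos_of_nonneg_of_le_pi (by linarith) h (by linarith)
      · rw [← cos_two_pi_sub (β + ψ / 2)]
        exact cos_le_cos_of_nonneg_of_le_pi (by linarith) (by linarith) (by linarith)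
    rw [cos_sub] at i1
    rw [cos_add] at i2
    linarith
  have main : 2 * cos (ψ / 2) * cos α < cos δ₀ + cos δ := by
    rcases le_total α π with h | h
    · exact aux α h ha
    · have := aux (2 * π - α) (by linarith) hb.le
      rwa [cos_two_pi_sub] at this
  nlinarith [mul_pos (sub_pos.2 hlt) (sub_pos.2 main)]

/-- the maximizer of `λ^l`. -/
theorem lambda_maximizer (b0 ψ : ℝ) (hb0 : 0 < b0) (hb1 : b0 < 1)
    (hψ0 : 0 < ψ) (hψ1 : ψ < π / 8) :
    ∀ l : ℕ, 2 ≤ l → l ≤ lmaxN ψ →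
      ∀ i₀ i₀' : ℕ, i₀ ∈ lambdaDom ψ l → i₀' ∈ lambdaDom ψ l →
        (i₀' = (l + 1) / 2 ∨ i₀' = (l + 2) / 2) →
        ∀ y y' : ℕ → ℂ, memU b0 ψ l i₀ y → memU b0 ψ l i₀' y' →
          ‖y (l + 1) - y 1‖ ≤ ‖y' (l + 1) - y' 1‖ ∧
          (‖y (l + 1) - y 1‖ = ‖y' (l + 1) - y' 1‖ ↔
            (i₀ = (l + 1) / 2 ∨ i₀ = (l + 2) / 2)) := by
  intro l hl2 hlm i₀ i₀' hi hi' hmid y y' hy hy'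
  have c1 := closed hb0 hy
  have c2 := closed hb0 hy'
  have b1 := hy.1
  have b2 := hy.2.1
  have b1' := hy'.1
  have b2' := hy'.2.1
  have n1 := norm_form ψ l i₀ (by omega)
  have n2 := norm_form ψ l i₀' (by omega)
  set D := ‖Complex.exp (ψ * Complex.I) - 1‖ with hD
  have hDpos : 0 < D := by
    rw [hD, norm_pos_iff, sub_ne_zero]
    intro h
    have := congrArg Complex.im h
    rw [Complex.exp_ofReal_mul_I_im, Complex.one_im] at this
    have := sin_pos_of_pos_of_lt_pi hψ0 (by linarith [pi_pos])
    linarith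
  set X := ‖Complex.exp (ψ * Complex.I) ^ i₀ + Complex.exp (ψ * Complex.I) ^ (l + 1 - i₀)
        - 1 - Complex.exp (ψ * Complex.I)‖ with hX
  set X' := ‖Complex.exp (ψ * Complex.I) ^ i₀' + Complex.exp (ψ * Complex.I) ^ (l + 1 - i₀')
        - 1 - Complex.exp (ψ * Complex.I)‖ with hX'
  have hX0 : 0 ≤ X := norm_nonneg _
  have hX0' : 0 ≤ X' := norm_nonneg _
  have cast : ∀ j : ℕ, |2 * (j : ℝ) - l - 1| = ((|2 * (j : ℤ) - l - 1| : ℤ) : ℝ) := by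
    intro j; push_cast; rfl
  rw [cast] at n1 n2
  have m1 : |2 * (i₀' : ℤ) - l - 1| ≤ 1 := by rw [abs_le]; omega
  by_cases hopt : i₀ = (l + 1) / 2 ∨ i₀ = (l + 2) / 2
  · have e : |2 * (i₀ : ℤ) - l - 1| = |2 * (i₀' : ℤ) - l - 1| := by
      rw [abs_eq_abs]; omega
    rw [e, ← n2] at n1
    have : X = X' := (sq_eq_sq₀ hX0 hX0').1 n1
    have : ‖y (l + 1) - y 1‖ = ‖y' (l + 1) - y' 1‖ := by
      apply mul_right_cancel₀ hDpos.ne'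
      rw [c1, c2, this]
    exact ⟨this.le, fun _ => hopt, fun _ => this⟩
  · have lt : |2 * (i₀' : ℤ) - l - 1| < |2 * (i₀ : ℤ) - l - 1| := by
      rcases abs_cases (2 * (i₀' : ℤ) - l - 1) with h | h <;>
      rcases abs_cases (2 * (i₀ : ℤ) - l - 1) with h' | h' <;> omega
    have up : |2 * (i₀ : ℤ) - l - 1| ≤ l - 3 := by rw [abs_le]; omega
    unfold lambdaDom at hi
    obtain ⟨-, hN1, hN2⟩ := Finset.mem_filter.1 hi
    have up2 : |2 * (i₀ : ℤ) - l - 1| ≤ 2 * nceil ψ - l - 5 := by rw [abs_le]; omega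
    have hN : ((nceil ψ : ℝ) - 1) * ψ < 2 * π := by
      have := Nat.ceil_lt_add_one (show 0 ≤ 2 * π / ψ by positivity)
      rw [← lt_div_iff₀ hψ0]
      unfold nceil
      linarith
    have m1r : ((|2 * (i₀' : ℤ) - l - 1| : ℤ) : ℝ) ≤ 1 := by exact_mod_cast m1
    have ltr : ((|2 * (i₀' : ℤ) - l - 1| : ℤ) : ℝ) < ((|2 * (i₀ : ℤ) - l - 1| : ℤ) : ℝ) := by
      exact_mod_cast lt
    have upr : ((|2 * (i₀ : ℤ) - l - 1| : ℤ) : ℝ) ≤ l - 3 := by exact_mod_cast up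
    have up2r : ((|2 * (i₀ : ℤ) - l - 1| : ℤ) : ℝ) ≤ 2 * nceil ψ - l - 5 := by
      exact_mod_cast up2
    have nn : (0 : ℝ) ≤ ((|2 * (i₀' : ℤ) - l - 1| : ℤ) : ℝ) := by
      exact_mod_cast abs_nonneg _
    generalize ((|2 * (i₀' : ℤ) - l - 1| : ℤ) : ℝ) = d' at *
    generalize ((|2 * (i₀ : ℤ) - l - 1| : ℤ) : ℝ) = d at *
    have k := key (ψ := ψ) (α := l * ψ / 2) (δ := d * ψ / 2) (δ₀ := d' * ψ / 2) hψ0 hψ1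
      (by positivity) (by nlinarith) (by nlinarith) (by nlinarith) (by nlinarith)
    have hlt : X < X' := by
      apply lt_of_pow_lt_pow_left₀ 2 hX0'
      rw [n1, n2]; linarith
    have : ‖y (l + 1) - y 1‖ < ‖y' (l + 1) - y' 1‖ := by
      apply lt_of_mul_lt_mul_right _ hDpos.le
      rw [c1, c2]
      exact mul_lt_mul_of_pos_left hlt hb0
    exact ⟨this.le, fun h => absurd h this.ne, fun h => absurd h hopt⟩


end
end
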